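/- arXiv:2502.10274 — 3 statements merged into one kernel-verified Lean document; each statement's English description precedes it below -/
import Mathlib

section
/- Let n ≥ 1 be an integer. There exists a continuously differentiable function R on the interval [1/2, 3/2] such that I_{n,1}(σ) = −(2/√σ)·log|1 − σ| + R(σ) for all σ with 0 < |σ − 1| ≤ 1/2, where I_{n,1}(σ) = ∫_{−π}^{π} cos(nβ)/|σ − e^{iβ}| dβ. -/
/-- `|σ - e^{iβ}| = √(σ² - 2σ cos β + 1)`. -/
noncomputable def Kker (σ β : ℝ) : ℝ := Real.sqrt (σ^2 - 2*σ*Real.cos β + 1)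

/-- `I_{n,1}(σ) = ∫_{-π}^{π} cos(nβ)/|σ - e^{iβ}| dβ`. -/
noncomputable def Ione (n : ℕ) (σ : ℝ) : ℝ :=
  ∫ β in (-Real.pi)..Real.pi, Real.cos (n*β) / Kker σ β

lemma aux_sin (n : ℕ) (x : ℝ) : |Real.sin (n * x)| ≤ n * |Real.sin x| := by
  induction n with
  | zero => simp
  | succ k ih =>
    have e : ((k + 1 : ℕ) : ℝ) * x = k * x + x := by push_cast; ring
    rw [e, Real.sin_add]
    have h1 := Real.abs_cos_le_one (k * x)
    have h2 := Real.abs_cos_le_one x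
    calc |Real.sin (k * x) * Real.cos x + Real.cos (k * x) * Real.sin x|
        ≤ |Real.sin (k * x)| * |Real.cos x| + |Real.cos (k * x)| * |Real.sin x| := by
          rw [← abs_mul, ← abs_mul]; exact abs_add_le _ _
      _ ≤ |Real.sin (k * x)| * 1 + 1 * |Real.sin x| := by gcongr
      _ ≤ _ := by push_cast; linarith

noncomputable def hfun (n : ℕ) (β : ℝ) : ℝ := Real.cos (n * β) - Real.cos (β / 2)

lemma hfun_cont (n : ℕ) : Continuous (hfun n) := by unfold hfun; fun_prop

lemma hfun_bound (n : ℕ) (β : ℝ) (h1 : -Real.pi ≤ β) (h2 : β ≤ Real.pi) :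
    |hfun n β| ≤ (2 * n ^ 2 + 1) * Real.sin (β / 2) ^ 2 := by
  have hc : 0 ≤ Real.cos (β / 2) := Real.cos_nonneg_of_mem_Icc ⟨by linarith, by linarith⟩
  have hc1 := Real.cos_le_one (β / 2)
  have hp := Real.sin_sq_add_cos_sq (β / 2)
  have e : Real.cos (n * β) = 1 - 2 * Real.sin (n * (β / 2)) ^ 2 := by
    rw [Real.sin_sq_eq_half_sub]; ring_nf
  have hs : Real.sin (n * (β / 2)) ^ 2 ≤ n ^ 2 * Real.sin (β / 2) ^ 2 := by
    rw [← sq_abs, ← sq_abs (Real.sin (β / 2)), ← mul_pow]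
    exact pow_le_pow_left₀ (abs_nonneg _) (aux_sin n _) 2
  unfold hfun
  rw [e, abs_le]
  constructor <;> nlinarith [sq_nonneg (Real.sin (n * (β / 2))), sq_nonneg (Real.sin (β / 2)), sq_nonneg ((n : ℝ) * Real.sin (β / 2))]

noncomputable def Gk (n : ℕ) (k β : ℝ) : ℝ := hfun n β / Real.sqrt (k ^ 2 + Real.sin (β / 2) ^ 2)
noncomputable def Gk' (n : ℕ) (k β : ℝ) : ℝ :=
  - (k * hfun n β) / (Real.sqrt (k ^ 2 + Real.sin (β / 2) ^ 2)) ^ 3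

lemma Gk_bound (n : ℕ) (k β : ℝ) (h1 : -Real.pi ≤ β) (h2 : β ≤ Real.pi) :
    |Gk n k β| ≤ (2 * n ^ 2 + 1) := by
  have hb := hfun_bound n β h1 h2
  have hs1 : |Real.sin (β / 2)| ≤ 1 := Real.abs_sin_le_one _
  unfold Gk
  rw [abs_div, abs_of_nonneg (Real.sqrt_nonneg _)]
  apply div_le_of_le_mul₀ (Real.sqrt_nonneg _) (by positivity)
  refine hb.trans ?_
  have : |Real.sin (β / 2)| ≤ Real.sqrt (k ^ 2 + Real.sin (β / 2) ^ 2) :=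
    Real.abs_le_sqrt (by nlinarith)
  have h3 : Real.sin (β / 2) ^ 2 ≤ |Real.sin (β / 2)| := by
    rw [← sq_abs]; nlinarith [abs_nonneg (Real.sin (β / 2))]
  gcongr
  linarith

lemma Gk'_bound (n : ℕ) (k β : ℝ) (h1 : -Real.pi ≤ β) (h2 : β ≤ Real.pi) :
    |Gk' n k β| ≤ (2 * n ^ 2 + 1) := by
  have hb := hfun_bound n β h1 h2
  unfold Gk'
  rw [abs_div, abs_neg, abs_mul, abs_of_nonneg (pow_nonneg (Real.sqrt_nonneg _) 3)]
  apply div_le_of_le_mul₀ (by positivity) (by positivity)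
  have h3 : |k| ≤ Real.sqrt (k ^ 2 + Real.sin (β / 2) ^ 2) :=
    Real.abs_le_sqrt (by nlinarith [sq_nonneg (Real.sin (β / 2))])
  have h4 : Real.sin (β / 2) ^ 2 ≤ Real.sqrt (k ^ 2 + Real.sin (β / 2) ^ 2) ^ 2 := by
    rw [Real.sq_sqrt (by positivity)]; nlinarith [sq_nonneg k]
  calc |k| * |hfun n β| ≤ Real.sqrt (k ^ 2 + Real.sin (β / 2) ^ 2) *
        ((2 * n ^ 2 + 1) * Real.sqrt (k ^ 2 + Real.sin (β / 2) ^ 2) ^ 2) := by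
        gcongr
        exact hb.trans (by gcongr)
    _ = _ := by ring

lemma Gk_deriv (n : ℕ) (k β : ℝ) (h1 : -Real.pi ≤ β) (h2 : β ≤ Real.pi) :
    HasDerivAt (fun k => Gk n k β) (Gk' n k β) k := by
  have hb := hfun_bound n β h1 h2
  by_cases hs : Real.sin (β / 2) = 0
  · have : hfun n β = 0 := by
      rw [hs] at hb; simpa using hb
    simp only [Gk, Gk', this]
    simpa using hasDerivAt_const k (0 : ℝ)
  · have hpos : 0 < k ^ 2 + Real.sin (β / 2) ^ 2 := by positivity
    have hd : HasDerivAt (fun k : ℝ => k ^ 2 + Real.sin (β / 2) ^ 2) (2 * k) k := by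
      simpa using (hasDerivAt_pow 2 k).add_const (Real.sin (β / 2) ^ 2)
    have := (hasDerivAt_const k (hfun n β)).div (hd.sqrt hpos.ne') (Real.sqrt_pos.2 hpos).ne'
    unfold Gk Gk'
    refine this.congr_deriv ?_
    have := (Real.sqrt_pos.2 hpos).ne'
    field_simp
    ring

lemma Gk'_cont (n : ℕ) (β : ℝ) (h1 : -Real.pi ≤ β) (h2 : β ≤ Real.pi) :
    Continuous (fun k => Gk' n k β) := by
  have hb := hfun_bound n β h1 h2
  by_cases hs : Real.sin (β / 2) = 0
  · have : hfun n β = 0 := by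
      rw [hs] at hb; simpa using hb
    simp only [Gk', this]
    simpa using continuous_const
  · unfold Gk'
    refine Continuous.div (by fun_prop) (by fun_prop) (fun k => ?_)
    have hpos : 0 < k ^ 2 + Real.sin (β / 2) ^ 2 := by positivity
    positivity

lemma Gk_meas (n : ℕ) (k : ℝ) : Measurable (Gk n k) := by
  have := (hfun_cont n).measurable
  unfold Gk
  fun_prop

lemma Gk'_meas (n : ℕ) (k : ℝ) : Measurable (Gk' n k) := by
  have := (hfun_cont n).measurable
  unfold Gk'
  fun_prop

noncomputable def HH (n : ℕ) (k : ℝ) : ℝ := ∫ β in (-Real.pi)..Real.pi, Gk n k β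

lemma mem_aux {β : ℝ} (h : β ∈ Set.uIoc (-Real.pi) Real.pi) : -Real.pi ≤ β ∧ β ≤ Real.pi := by
  rw [Set.uIoc_of_le (by linarith [Real.pi_pos])] at h
  exact ⟨h.1.le, h.2⟩

lemma Gk_int (n : ℕ) (k : ℝ) :
    IntervalIntegrable (Gk n k) MeasureTheory.volume (-Real.pi) Real.pi := by
  refine IntervalIntegrable.mono_fun' (g := fun _ => (2 * (n : ℝ) ^ 2 + 1))
    intervalIntegrable_const (Gk_meas n k).aestronglyMeasurable ?_
  refine (MeasureTheory.ae_restrict_iff' measurableSet_uIoc).2 (Filter.Eventually.of_forall ?_)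
  intro β hβ
  exact Gk_bound n k β (mem_aux hβ).1 (mem_aux hβ).2

lemma HH_deriv (n : ℕ) (k : ℝ) :
    HasDerivAt (HH n) (∫ β in (-Real.pi)..Real.pi, Gk' n k β) k := by
  refine (intervalIntegral.hasDerivAt_integral_of_dominated_loc_of_deriv_le
    (F := Gk n) (F' := Gk' n) (bound := fun _ => (2 * (n : ℝ) ^ 2 + 1)) (s := Set.univ)
    Filter.univ_mem
    (Filter.Eventually.of_forall fun k => (Gk_meas n k).aestronglyMeasurable)
    (Gk_int n k) (Gk'_meas n k).aestronglyMeasurable ?_ intervalIntegrable_const ?_).2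
  · exact Filter.Eventually.of_forall fun β hβ k _ => Gk'_bound n k β (mem_aux hβ).1 (mem_aux hβ).2
  · exact Filter.Eventually.of_forall fun β hβ k _ => Gk_deriv n k β (mem_aux hβ).1 (mem_aux hβ).2

lemma HH_contDiff (n : ℕ) : ContDiff ℝ 1 (HH n) := by
  rw [contDiff_one_iff_deriv]
  refine ⟨fun k => (HH_deriv n k).differentiableAt, ?_⟩
  have : deriv (HH n) = fun k => ∫ β in (-Real.pi)..Real.pi, Gk' n k β :=
    funext fun k => (HH_deriv n k).deriv
  rw [this]
  refine intervalIntegral.continuous_of_dominated_interval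
    (bound := fun _ => (2 * (n : ℝ) ^ 2 + 1))
    (fun k => (Gk'_meas n k).aestronglyMeasurable) ?_ intervalIntegrable_const ?_
  · exact fun k => Filter.Eventually.of_forall fun β hβ =>
      Gk'_bound n k β (mem_aux hβ).1 (mem_aux hβ).2
  · exact Filter.Eventually.of_forall fun β hβ => Gk'_cont n β (mem_aux hβ).1 (mem_aux hβ).2

lemma main_cont (k : ℝ) (hk : k ≠ 0) :
    Continuous (fun β => Real.cos (β / 2) / Real.sqrt (k ^ 2 + Real.sin (β / 2) ^ 2)) := by
  refine Continuous.div (by fun_prop) (by fun_prop) (fun β => ?_)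
  have hpos : 0 < k ^ 2 + Real.sin (β / 2) ^ 2 := by positivity
  positivity

lemma main_int (k : ℝ) (hk : k ≠ 0) :
    ∫ β in (-Real.pi)..Real.pi, Real.cos (β / 2) / Real.sqrt (k ^ 2 + Real.sin (β / 2) ^ 2)
      = 4 * (Real.log (1 + Real.sqrt (1 + k ^ 2)) - Real.log |k|) := by
  have hk' : 0 < |k| := abs_pos.2 hk
  have hd : ∀ β : ℝ, HasDerivAt (fun β => 2 * Real.arsinh (Real.sin (β / 2) / |k|))
      (Real.cos (β / 2) / Real.sqrt (k ^ 2 + Real.sin (β / 2) ^ 2)) β := by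
    intro β
    have h0 : HasDerivAt (fun β : ℝ => β / 2) (1 / 2) β := (hasDerivAt_id β).div_const 2
    have h1 := ((h0.sin.div_const |k|).arsinh).const_mul 2
    refine h1.congr_deriv ?_
    have e : Real.sqrt (k ^ 2 + Real.sin (β / 2) ^ 2)
        = |k| * Real.sqrt (1 + (Real.sin (β / 2) / |k|) ^ 2) := by
      rw [← Real.sqrt_sq_eq_abs k, ← Real.sqrt_mul (sq_nonneg k), Real.sqrt_sq_eq_abs]
      congr 1
      rw [div_pow, sq_abs]; field_simp
    rw [e]
    have : 0 < Real.sqrt (1 + (Real.sin (β / 2) / |k|) ^ 2) := by positivity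
    simp only [smul_eq_mul]
    field_simp
  rw [intervalIntegral.integral_eq_sub_of_hasDerivAt (fun β _ => hd β)
    ((main_cont k hk).intervalIntegrable _ _)]
  have e2 : Real.arsinh (1 / |k|) = Real.log (1 + Real.sqrt (1 + k ^ 2)) - Real.log |k| := by
    rw [Real.arsinh, ← Real.log_div (by positivity) hk'.ne']
    congr 1
    have : Real.sqrt (1 + (1 / |k|) ^ 2) = Real.sqrt (1 + k ^ 2) / |k| := by
      rw [eq_div_iff hk'.ne', ← Real.sqrt_sq_eq_abs k, ← Real.sqrt_mul (by positivity),
        Real.sqrt_sq_eq_abs]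
      congr 1
      rw [div_pow, sq_abs]; field_simp; ring
    rw [this]; ring
  have e3 : Real.sin (-Real.pi / 2) = -1 := by
    rw [neg_div, Real.sin_neg, Real.sin_pi_div_two]
  rw [e3, Real.sin_pi_div_two, neg_div, Real.arsinh_neg, e2]
  ring

lemma Kker_eq (σ β : ℝ) (hσ : 0 < σ) :
    Kker σ β = 2 * Real.sqrt σ *
      Real.sqrt (((1 - σ) / (2 * Real.sqrt σ)) ^ 2 + Real.sin (β / 2) ^ 2) := by
  have h : 0 < Real.sqrt σ := Real.sqrt_pos.2 hσ
  have e : (2 * Real.sqrt σ) = Real.sqrt ((2 * Real.sqrt σ) ^ 2) :=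
    (Real.sqrt_sq (by positivity)).symm
  have hq := Real.sq_sqrt hσ.le
  have hc : Real.cos β = 1 - 2 * Real.sin (β / 2) ^ 2 := by
    rw [Real.sin_sq_eq_half_sub]; ring_nf
  unfold Kker
  nth_rewrite 1 [e]
  rw [← Real.sqrt_mul (by positivity)]
  congr 1
  rw [mul_add, ← mul_pow, mul_div_cancel₀ _ (by positivity), mul_pow, hq, hc]
  ring

theorem stmt3 (n : ℕ) (hn : 1 ≤ n) :
    ∃ R : ℝ → ℝ, ContDiffOn ℝ 1 R (Set.Icc (1/2 : ℝ) (3/2)) ∧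
      ∀ σ : ℝ, 0 < |σ - 1| → |σ - 1| ≤ 1/2 →
        Ione n σ = -(2 / Real.sqrt σ) * Real.log |1 - σ| + R σ := by
  refine ⟨fun σ => (2 / Real.sqrt σ) * (Real.log (2 * Real.sqrt σ) +
      Real.log (1 + Real.sqrt (1 + ((1 - σ) / (2 * Real.sqrt σ)) ^ 2)))
      + 1 / (2 * Real.sqrt σ) * HH n ((1 - σ) / (2 * Real.sqrt σ)), ?_, ?_⟩
  · have hs : ContDiffOn ℝ 1 (fun σ : ℝ => Real.sqrt σ) (Set.Icc (1/2 : ℝ) (3/2)) :=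
      contDiffOn_id.sqrt (fun x hx => by have := hx.1; simp only [id]; intro h; linarith)
    have hs0 : ∀ x ∈ Set.Icc (1/2 : ℝ) (3/2), 0 < Real.sqrt x := fun x hx =>
      Real.sqrt_pos.2 (by linarith [hx.1])
    have h2s : ContDiffOn ℝ 1 (fun σ : ℝ => 2 * Real.sqrt σ) (Set.Icc (1/2 : ℝ) (3/2)) :=
      contDiffOn_const.mul hs
    have h2s0 : ∀ x ∈ Set.Icc (1/2 : ℝ) (3/2), 2 * Real.sqrt x ≠ 0 := fun x hx => by
      have := hs0 x hx; positivity
    have hk : ContDiffOn ℝ 1 (fun σ : ℝ => (1 - σ) / (2 * Real.sqrt σ))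
        (Set.Icc (1/2 : ℝ) (3/2)) :=
      (contDiffOn_const.sub contDiffOn_id).div h2s h2s0
    refine ContDiffOn.add (ContDiffOn.mul (contDiffOn_const.div hs fun x hx => (hs0 x hx).ne')
      (ContDiffOn.add (h2s.log h2s0) (ContDiffOn.log (contDiffOn_const.add
        (ContDiffOn.sqrt (contDiffOn_const.add (hk.pow 2)) ?_)) ?_)))
      (ContDiffOn.mul (contDiffOn_const.div h2s h2s0) ((HH_contDiff n).comp_contDiffOn hk))
    · intro x _; positivity
    · intro x _; positivity
  · intro σ h1 h2
    have hσ : 0 < σ := by have := (abs_le.1 h2).1; linarith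
    have hq : 0 < Real.sqrt σ := Real.sqrt_pos.2 hσ
    have h3 : 1 - σ ≠ 0 := by
      intro h; have : σ - 1 = 0 := by linarith
      rw [this] at h1; simp at h1
    have hk : (1 - σ) / (2 * Real.sqrt σ) ≠ 0 := by positivity
    have hI : Ione n σ = 1 / (2 * Real.sqrt σ) *
        (4 * (Real.log (1 + Real.sqrt (1 + ((1 - σ) / (2 * Real.sqrt σ)) ^ 2))
          - Real.log |(1 - σ) / (2 * Real.sqrt σ)|) + HH n ((1 - σ) / (2 * Real.sqrt σ))) := by
      rw [← main_int _ hk, HH, ← intervalIntegral.integral_add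
        ((main_cont _ hk).intervalIntegrable _ _) (Gk_int n _),
        ← intervalIntegral.integral_const_mul, Ione]
      congr 1
      funext β
      rw [Kker_eq σ β hσ, Gk, hfun, ← add_div, div_mul_div_comm]
      congr 1
      ring
    rw [hI, abs_div, Real.log_div (abs_ne_zero.2 h3) (by positivity),
      abs_of_pos (by positivity : 0 < 2 * Real.sqrt σ)]
    simp only
    field_simp
    ring
end

section
/- Let n ≥ 2 be an integer. For every real α with 0 < α < 3, the function σ ↦ J_{n,α}(σ) is continuous at σ = 1 and J_{n,α}(1) > 0. For every real α with 3 ≤ α < 5, J_{n,α}(σ) tends to +∞ as σ tends to 1 (through σ > 0 with σ ≠ 1). -/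
/-- `J_{n,α}(σ) = (1/α) ∫_{-π}^{π} (cos β - cos(nβ))/|σ - e^{iβ}|^α dβ`. -/
noncomputable def Jfun (n : ℕ) (α σ : ℝ) : ℝ :=
  (1/α) * ∫ β in (-Real.pi)..Real.pi, (Real.cos β - Real.cos (n*β)) / (Kker σ β) ^ α

theorem abs_sin_nat_mul_le (n : ℕ) (x : ℝ) : |Real.sin (n*x)| ≤ n * |Real.sin x| := by
  induction n with
  | zero => simp
  | succ k ih =>
    have e : ((k+1 : ℕ) : ℝ) * x = k*x + x := by push_cast; ring
    rw [e, Real.sin_add]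
    have h1 := Real.abs_cos_le_one x
    have h2 := Real.abs_cos_le_one (k*x)
    calc |Real.sin (k*x) * Real.cos x + Real.cos (k*x) * Real.sin x|
        ≤ |Real.sin (k*x)| * |Real.cos x| + |Real.cos (k*x)| * |Real.sin x| := by
          rw [← abs_mul, ← abs_mul]; exact abs_add_le _ _
      _ ≤ |Real.sin (k*x)| * 1 + 1 * |Real.sin x| := by gcongr
      _ ≤ ((k+1 : ℕ) : ℝ) * |Real.sin x| := by push_cast; linarith

noncomputable def Gs (n : ℕ) (β : ℝ) : ℝ := Real.sin β * (Real.sin β - Real.sin (n*β) / n)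

theorem Gs_nonneg (n : ℕ) (hn : 2 ≤ n) (β : ℝ) : 0 ≤ Gs n β := by
  have hn' : (0:ℝ) < n := by positivity
  have h := abs_sin_nat_mul_le n β
  have h2 : |Real.sin (n*β) / n| ≤ |Real.sin β| := by
    rw [abs_div, abs_of_pos hn', div_le_iff₀ hn']; linarith
  have h3 : Real.sin β * (Real.sin (n*β) / n) ≤ |Real.sin β| * |Real.sin β| := by
    calc _ ≤ |Real.sin β * (Real.sin (n*β) / n)| := le_abs_self _
      _ = |Real.sin β| * |Real.sin (n*β) / n| := abs_mul _ _
      _ ≤ _ := by gcongr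
  rw [abs_mul_abs_self] at h3
  unfold Gs
  linarith

theorem Gs_continuous (n : ℕ) : Continuous (Gs n) := by unfold Gs; fun_prop

theorem Gs_lower (n : ℕ) (hn : 2 ≤ n) (β : ℝ) (h0 : 0 < β) (h1 : n * β ≤ 1) :
    β^4 / 6 ≤ Gs n β := by
  have hn' : (2:ℝ) ≤ n := by exact_mod_cast hn
  have hb : β ≤ 1/2 := by nlinarith
  have hs : β / 2 ≤ Real.sin β := by
    have := Real.mul_le_sin h0.le (by linarith [Real.pi_gt_three])
    refine le_trans ?_ this
    have : 1/2 ≤ 2 / Real.pi := by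
      rw [div_le_div_iff₀ (by norm_num) Real.pi_pos]; linarith [Real.pi_le_four]
    nlinarith
  have b1 := abs_le.1 (Real.sin_bound (x := β) (by rw [abs_of_pos h0]; linarith))
  have hnb : 0 < n * β := by positivity
  have b2 := abs_le.1 (Real.sin_bound (x := n*β) (by rw [abs_of_pos hnb]; linarith))
  rw [abs_of_pos h0] at b1
  rw [abs_of_pos hnb] at b2
  have hG : β^3/3 ≤ Real.sin β - Real.sin (n*β) / n := by
    have e : Real.sin (n*β) / n ≤ β - n^2*β^3/6 + n^2*β^3/100 := by
      rw [div_le_iff₀ (by positivity)]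
      have : (n*β)^5 ≤ (n*β)^3 := pow_le_pow_of_le_one hnb.le h1 (by norm_num)
      have e2 : (β - n^2*β^3/6 + n^2*β^3/100) * n = n*β - (n*β)^3/6 + (n*β)^3/100 := by ring
      rw [e2]; linarith [b2.2]
    have : β^5 ≤ β^3 := pow_le_pow_of_le_one h0.le (by linarith) (by norm_num)
    have h4 : 4*β^3 ≤ n^2*β^3 := by
      have : (4:ℝ) ≤ n^2 := by nlinarith
      gcongr
    have : 0 < β^3 := by positivity
    linarith [b1.1]
  unfold Gs
  calc β^4/6 = β/2 * (β^3/3) := by ring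
    _ ≤ _ := by
      have : 0 ≤ Real.sin β := by linarith
      gcongr

theorem q_eq (σ β : ℝ) : σ^2 - 2*σ*Real.cos β + 1 = (1-σ)^2 + 4*σ*Real.sin (β/2)^2 := by
  have : Real.cos β = 1 - 2 * Real.sin (β/2)^2 := by
    have := Real.cos_two_mul' (β/2)
    rw [show 2*(β/2) = β by ring] at this
    linarith [Real.sin_sq_add_cos_sq (β/2)]
  rw [this]; ring

theorem q_pos (σ β : ℝ) (h : 0 < σ) (h1 : σ ≠ 1) : 0 < σ^2 - 2*σ*Real.cos β + 1 := by
  rw [q_eq]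
  have : 0 < (1-σ)^2 := by
    have : 1 - σ ≠ 0 := sub_ne_zero.2 h1.symm
    positivity
  positivity

theorem K_pos (σ β : ℝ) (h : 0 < σ) (h1 : σ ≠ 1) : 0 < Kker σ β := Real.sqrt_pos.2 (q_pos σ β h h1)

theorem J_ibp (n : ℕ) (hn : 2 ≤ n) (α σ : ℝ) (ha : 0 < α) (h : 0 < σ) (h1 : σ ≠ 1) :
    Jfun n α σ = σ * ∫ β in (-Real.pi)..Real.pi, Gs n β * (Kker σ β)^(-(α+2)) := by
  have hn' : (0:ℝ) < n := by positivity
  have hK : ∀ β p : ℝ, (Kker σ β)^p = (σ^2 - 2*σ*Real.cos β + 1)^(p/2) := by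
    intro β p
    unfold Kker
    rw [Real.sqrt_eq_rpow, ← Real.rpow_mul (q_pos σ β h h1).le]; congr 1; ring
  have hc : ∀ p : ℝ, Continuous fun β => (σ^2 - 2*σ*Real.cos β + 1)^p := fun p =>
    Continuous.rpow_const (by fun_prop) (fun β => Or.inl (q_pos σ β h h1).ne')
  have key := intervalIntegral.integral_mul_deriv_eq_deriv_mul (a := -Real.pi) (b := Real.pi)
    (u := fun β => (σ^2 - 2*σ*Real.cos β + 1)^(-α/2))
    (v := fun β => Real.sin β - Real.sin (n*β) / n)
    (u' := fun β => (2*σ*Real.sin β) * (-α/2) * (σ^2 - 2*σ*Real.cos β + 1)^(-α/2-1))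
    (v' := fun β => Real.cos β - Real.cos (n*β))
    (fun β _ => by
      refine HasDerivAt.rpow_const ?_ (Or.inl (q_pos σ β h h1).ne')
      have := (((Real.hasDerivAt_cos β).const_mul (2*σ)).const_sub (σ^2)).add_const 1
      exact this.congr_deriv (by ring))
    (fun β _ => by
      have h2 : HasDerivAt (fun β : ℝ => n*β) n β := by
        simpa using (hasDerivAt_id β).const_mul (n:ℝ)
      have := (Real.hasDerivAt_sin β).sub ((h2.sin).div_const n)
      exact this.congr_deriv (by field_simp))
    (by
      apply Continuous.intervalIntegrable
      exact (by fun_prop : Continuous fun β => (2*σ*Real.sin β) * (-α/2)).mul (hc _))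
    (by apply Continuous.intervalIntegrable; fun_prop)
  have z1 : Real.sin (n * Real.pi) = 0 := Real.sin_nat_mul_pi n
  have z2 : Real.sin (n * -Real.pi) = 0 := by rw [mul_neg, Real.sin_neg, z1, neg_zero]
  simp only [Real.sin_neg, Real.sin_pi, z1, z2] at key
  simp only [zero_div, sub_zero, neg_zero, mul_zero, zero_sub] at key
  unfold Jfun
  have e1 : ∀ β, (Real.cos β - Real.cos (n*β)) / (Kker σ β)^α =
      (σ^2 - 2*σ*Real.cos β + 1)^(-α/2) * (Real.cos β - Real.cos (n*β)) := by
    intro β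
    rw [hK, neg_div, Real.rpow_neg (q_pos σ β h h1).le]; field_simp
  simp only [e1]
  rw [key, ← intervalIntegral.integral_neg, ← intervalIntegral.integral_const_mul,
    ← intervalIntegral.integral_const_mul]
  congr 1; ext β
  rw [hK, show -α/2-1 = -(α+2)/2 by ring]
  unfold Gs
  field_simp

theorem K_cont (σ : ℝ) (h : 0 < σ) (h1 : σ ≠ 1) (p : ℝ) : Continuous fun β => (Kker σ β)^p := by
  refine Continuous.rpow_const (by unfold Kker; fun_prop) (fun β => Or.inl (K_pos σ β h h1).ne')

theorem J_lower_const (n : ℕ) (hn : 2 ≤ n) (α σ : ℝ) (ha : 0 < α) (h : 1/2 < σ) (h1 : σ ≠ 1)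
    (h2 : σ < 2) :
    1/2 * (3^(-(α+2)) * ∫ β in (-Real.pi)..Real.pi, Gs n β) ≤ Jfun n α σ := by
  have h0 : 0 < σ := by linarith
  rw [J_ibp n hn α σ ha h0 h1, ← intervalIntegral.integral_const_mul]
  have hpi := Real.pi_pos
  refine mul_le_mul h.le ?_ ?_ h0.le
  · refine intervalIntegral.integral_mono_on (by linarith) ?_ ?_ ?_
    · exact (continuous_const.mul (Gs_continuous n)).intervalIntegrable _ _
    · exact ((Gs_continuous n).mul (K_cont σ h0 h1 _)).intervalIntegrable _ _
    · intro β _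
      rw [mul_comm]
      refine mul_le_mul_of_nonneg_left ?_ (Gs_nonneg n hn β)
      refine Real.rpow_le_rpow_of_nonpos (K_pos σ β h0 h1) ?_ (by linarith)
      unfold Kker
      rw [Real.sqrt_le_left (by norm_num)]
      nlinarith [Real.neg_one_le_cos β]
  · refine intervalIntegral.integral_nonneg (by linarith) (fun β _ => ?_)
    exact mul_nonneg (by positivity) (Gs_nonneg n hn β)

theorem Gs_int_pos (n : ℕ) (hn : 2 ≤ n) : 0 < ∫ β in (-Real.pi)..Real.pi, Gs n β := by
  have hpi := Real.pi_pos
  refine intervalIntegral.integral_pos (by linarith) (Gs_continuous n).continuousOn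
    (fun β _ => Gs_nonneg n hn β) ⟨1/n, ?_, ?_⟩
  · have : (1:ℝ)/n ≤ 1 := by
      rw [div_le_one (by positivity)]; exact_mod_cast (by omega : 1 ≤ n)
    have : (0:ℝ) ≤ 1/n := by positivity
    constructor <;> linarith [Real.pi_gt_three]
  · have hn' : (0:ℝ) < n := by positivity
    refine lt_of_lt_of_le ?_ (Gs_lower n hn (1/n) (by positivity) (by field_simp; rfl))
    positivity

theorem J_div (n : ℕ) (hn : 2 ≤ n) (α σ : ℝ) (ha : 3 ≤ α) (h : 1/2 < σ) (h1 : σ ≠ 1)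
    (h2 : σ < 2) (h3 : |1-σ| < 1/n) :
    1/2 * (2^(-(α+2)) / 6 * (Real.log (1/n) - Real.log (1-σ))) ≤ Jfun n α σ := by
  have h0 : 0 < σ := by linarith
  have hn' : (0:ℝ) < n := by positivity
  have hn2 : (2:ℝ) ≤ n := by exact_mod_cast hn
  have hpi := Real.pi_pos
  have he : 0 < |1-σ| := abs_pos.2 (sub_ne_zero.2 h1.symm)
  have hd : (1:ℝ)/n ≤ 1 := by rw [div_le_one (by positivity)]; linarith
  rw [J_ibp n hn α σ (by linarith) h0 h1, ← Real.log_abs (1-σ),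
    ← Real.log_div (by positivity) he.ne', ← integral_inv_of_pos he (by positivity),
    ← intervalIntegral.integral_const_mul]
  have hci : ∀ a b, IntervalIntegrable (fun β => Gs n β * (Kker σ β)^(-(α+2))) MeasureTheory.volume a b :=
    fun a b => ((Gs_continuous n).mul (K_cont σ h0 h1 _)).intervalIntegrable _ _
  have hnn : ∀ β, 0 ≤ Gs n β * (Kker σ β)^(-(α+2)) := fun β =>
    mul_nonneg (Gs_nonneg n hn β) (Real.rpow_nonneg (K_pos σ β h0 h1).le _)
  have step : ∫ β in |1-σ|..(1/n), Gs n β * (Kker σ β)^(-(α+2)) ≤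
      ∫ β in (-Real.pi)..Real.pi, Gs n β * (Kker σ β)^(-(α+2)) :=
    intervalIntegral.integral_mono_interval (by linarith) h3.le (by linarith [Real.pi_gt_three])
      (Filter.Eventually.of_forall hnn) (hci _ _)
  have step2 : ∫ β in |1-σ|..(1/n), (2^(-(α+2)) / 6 * β⁻¹) ≤
      ∫ β in |1-σ|..(1/n), Gs n β * (Kker σ β)^(-(α+2)) := by
    refine intervalIntegral.integral_mono_on h3.le ?_ (hci _ _) ?_
    · refine ContinuousOn.intervalIntegrable ?_
      rw [Set.uIcc_of_le h3.le]
      exact continuousOn_const.mul (continuousOn_id.inv₀ (fun x hx => (he.trans_le hx.1).ne'))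
    · rintro β ⟨hl, hr⟩
      have hb : 0 < β := he.trans_le hl
      have hG := Gs_lower n hn β hb (by rw [le_div_iff₀ hn'] at hr; linarith)
      have hK : Kker σ β ≤ 2 * β := by
        unfold Kker
        rw [Real.sqrt_le_left (by positivity), q_eq]
        have a1 : (1-σ)^2 ≤ β^2 := sq_le_sq.2 (by rwa [abs_of_pos hb])
        have a2 : Real.sin (β/2)^2 ≤ (β/2)^2 := sq_le_sq.2 Real.abs_sin_le_abs
        nlinarith [sq_nonneg (Real.sin (β/2))]
      have hK2 : (2*β)^(-(α+2)) ≤ (Kker σ β)^(-(α+2)) :=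
        Real.rpow_le_rpow_of_nonpos (K_pos σ β h0 h1) hK (by linarith)
      calc 2^(-(α+2)) / 6 * β⁻¹ ≤ 2^(-(α+2)) / 6 * β^(2-α) := by
            gcongr
            rw [← Real.rpow_neg_one]
            exact Real.rpow_le_rpow_of_exponent_ge hb (hr.trans hd) (by linarith)
        _ = β^4/6 * (2*β)^(-(α+2)) := by
            rw [Real.mul_rpow (by norm_num) hb.le, show (2-α) = (4:ℕ) + (-(α+2)) by push_cast; ring,
              Real.rpow_add hb, Real.rpow_natCast]
            ring
        _ ≤ _ := by gcongr; exact Gs_nonneg n hn β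
  refine mul_le_mul h.le (step2.trans step) ?_ h0.le
  refine intervalIntegral.integral_nonneg h3.le (fun β hβ => ?_)
  have : 0 < β := he.trans_le hβ.1
  positivity

theorem bound_int (γ c : ℝ) (hγ : γ < 1) :
    IntervalIntegrable (fun β : ℝ => c * (|β| / Real.pi)^(-γ)) MeasureTheory.volume (-Real.pi) Real.pi := by
  have hpi := Real.pi_pos
  have hr : IntervalIntegrable (fun β : ℝ => c * (|β| / Real.pi)^(-γ)) MeasureTheory.volume 0 Real.pi := by
    have := (intervalIntegral.intervalIntegrable_rpow' (a := 0) (b := Real.pi) (r := -γ)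
      (by linarith)).const_mul (c * (Real.pi^(-γ))⁻¹)
    refine this.congr ?_
    intro x hx
    rw [Set.uIoc_of_le hpi.le] at hx
    simp only
    rw [abs_of_pos hx.1, Real.div_rpow hx.1.le hpi.le]
    ring
  have hl : IntervalIntegrable (fun β : ℝ => c * (|β| / Real.pi)^(-γ)) MeasureTheory.volume (-Real.pi) 0 := by
    rw [IntervalIntegrable.iff_comp_neg]
    simpa using hr.symm
  exact hl.trans hr

theorem J_cont (n : ℕ) (α : ℝ) (ha : 0 < α) (h3 : α < 3) : ContinuousAt (Jfun n α) 1 := by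
  have hpi := Real.pi_pos
  unfold Jfun
  refine continuousAt_const.mul ?_
  set γ := max (α-2) 0 with hγ
  have hγ1 : γ < 1 := max_lt (by linarith) (by norm_num)
  have hγ0 : 0 ≤ γ := le_max_right _ _
  have hγ2 : α - 2 ≤ γ := le_max_left _ _
  have hae : ∀ᵐ β : ℝ, β ≠ 0 := MeasureTheory.Measure.ae_ne _ 0
  have hsin : ∀ β : ℝ, β ∈ Set.uIoc (-Real.pi) Real.pi → β ≠ 0 →
      0 < |β| / Real.pi ∧ |β| / Real.pi ≤ |Real.sin (β/2)| := by
    intro β hβ hb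
    rw [Set.uIoc_of_le (by linarith)] at hβ
    refine ⟨by positivity, ?_⟩
    have hb2 : |β/2| ≤ Real.pi / 2 := by
      rw [abs_div, abs_two]
      have := abs_le.2 ⟨hβ.1.le, hβ.2⟩
      linarith
    have := Real.mul_abs_le_abs_sin hb2
    rw [abs_div, abs_two] at this
    refine le_trans (le_of_eq ?_) this
    field_simp
  refine intervalIntegral.continuousAt_of_dominated_interval
    (bound := fun β => (2*(1+n^2)) * (|β| / Real.pi)^(-γ)) ?_ ?_ (bound_int γ _ hγ1) ?_
  · refine Filter.Eventually.of_forall (fun σ => ?_)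
    refine Measurable.aestronglyMeasurable ?_
    unfold Kker
    fun_prop
  · filter_upwards [lt_mem_nhds (show (1/2:ℝ) < 1 by norm_num)] with σ hσ
    filter_upwards [hae] with β hb hβ
    obtain ⟨p0, p1⟩ := hsin β hβ hb
    set s := |Real.sin (β/2)| with hs
    have s0 : 0 < s := p0.trans_le p1
    have s1 : s ≤ 1 := Real.abs_sin_le_one _
    have hK : s ≤ Kker σ β := by
      unfold Kker
      refine Real.le_sqrt_of_sq_le ?_
      rw [q_eq, hs, sq_abs]
      nlinarith [sq_nonneg (Real.sin (β/2)), sq_nonneg (1-σ)]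
    have hcos : ∀ x : ℝ, Real.cos x = 1 - 2 * Real.sin (x/2)^2 := by
      intro x
      have := Real.cos_two_mul' (x/2)
      rw [show 2*(x/2) = x by ring] at this
      linarith [Real.sin_sq_add_cos_sq (x/2)]
    have hnum : |Real.cos β - Real.cos (n*β)| ≤ 2*(1+n^2) * s^2 := by
      have t := abs_sin_nat_mul_le n (β/2)
      rw [← hs] at t
      have t2 : Real.sin (n*β/2)^2 ≤ (n*s)^2 := by
        rw [show (n:ℝ)*β/2 = n*(β/2) by ring, ← sq_abs]
        gcongr
      rw [hcos β, hcos (n*β), ← sq_abs (Real.sin (β/2)), ← hs, abs_le]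
      constructor <;> nlinarith [sq_nonneg s, sq_nonneg (n*s), sq_nonneg (Real.sin (n*β/2))]
    rw [Real.norm_eq_abs, abs_div, abs_of_nonneg (Real.rpow_nonneg (s0.le.trans hK) α)]
    calc |Real.cos β - Real.cos (n*β)| / Kker σ β ^ α ≤ (2*(1+n^2) * s^2) / s^α := by gcongr
      _ = 2*(1+n^2) * s^(2-α) := by
        rw [Real.rpow_sub s0, Real.rpow_two]; ring
      _ ≤ 2*(1+n^2) * s^(-γ) := by
        gcongr 2*(1+(n:ℝ)^2) * ?_
        exact Real.rpow_le_rpow_of_exponent_ge s0 s1 (by linarith)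
      _ ≤ 2*(1+n^2) * (|β| / Real.pi)^(-γ) := by
        gcongr 2*(1+(n:ℝ)^2) * ?_
        exact Real.rpow_le_rpow_of_nonpos p0 p1 (by linarith)
  · filter_upwards [hae] with β hb hβ
    obtain ⟨p0, p1⟩ := hsin β hβ hb
    have s0 := p0.trans_le p1
    have hK : 0 < Kker 1 β := by
      unfold Kker
      rw [Real.sqrt_pos, q_eq, ← sq_abs (Real.sin _)]
      positivity
    have hc : ContinuousAt (fun σ => Kker σ β) 1 := by
      unfold Kker
      fun_prop
    exact continuousAt_const.div (hc.rpow_const (Or.inl hK.ne')) (Real.rpow_pos_of_pos hK α).ne'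

theorem stmt4 (n : ℕ) (hn : 2 ≤ n) :
    (∀ α : ℝ, 0 < α → α < 3 →
      ContinuousAt (Jfun n α) 1 ∧ 0 < Jfun n α 1) ∧
    (∀ α : ℝ, 3 ≤ α → α < 5 →
      Filter.Tendsto (Jfun n α)
        (nhdsWithin 1 {σ : ℝ | 0 < σ ∧ σ ≠ 1}) Filter.atTop) := by
  refine ⟨fun α ha h3 => ?_, fun α ha _ => ?_⟩
  · have hc := J_cont n α ha h3
    refine ⟨hc, ?_⟩
    have hpos := Gs_int_pos n hn
    have hl : 1/2 * (3^(-(α+2)) * ∫ β in (-Real.pi)..Real.pi, Gs n β) ≤ Jfun n α 1 := by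
      refine ge_of_tendsto (hc.tendsto.mono_left (nhdsWithin_le_nhds (s := {1}ᶜ))) ?_
      filter_upwards [self_mem_nhdsWithin,
        mem_nhdsWithin_of_mem_nhds (lt_mem_nhds (show (1/2:ℝ) < 1 by norm_num)),
        mem_nhdsWithin_of_mem_nhds (gt_mem_nhds (show (1:ℝ) < 2 by norm_num))] with σ a b c
      exact J_lower_const n hn α σ ha b a c
    refine lt_of_lt_of_le ?_ hl
    positivity
  · have hn' : (0:ℝ) < n := by positivity
    have hb : ∀ᶠ σ in nhdsWithin (1:ℝ) {σ : ℝ | 0 < σ ∧ σ ≠ 1},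
        1/2 * (2^(-(α+2)) / 6 * (Real.log (1/n) - Real.log (1-σ))) ≤ Jfun n α σ := by
      have hnear : ∀ᶠ σ in nhds (1:ℝ), |1-σ| < 1/(n:ℝ) := by
        have : Filter.Tendsto (fun σ : ℝ => |1-σ|) (nhds 1) (nhds |1-1|) :=
          Continuous.tendsto (by fun_prop) 1
        refine this.eventually_lt_const ?_
        simp; omega
      filter_upwards [self_mem_nhdsWithin,
        mem_nhdsWithin_of_mem_nhds (lt_mem_nhds (show (1/2:ℝ) < 1 by norm_num)),
        mem_nhdsWithin_of_mem_nhds (gt_mem_nhds (show (1:ℝ) < 2 by norm_num)),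
        mem_nhdsWithin_of_mem_nhds hnear] with σ a b c d
      exact J_div n hn α σ ha b a.2 c d
    refine Filter.tendsto_atTop_mono' _ hb ?_
    refine Filter.Tendsto.const_mul_atTop (by norm_num) ?_
    refine Filter.Tendsto.const_mul_atTop (by positivity) ?_
    have hlog : Filter.Tendsto (fun σ : ℝ => Real.log (1-σ))
        (nhdsWithin 1 {σ : ℝ | 0 < σ ∧ σ ≠ 1}) Filter.atBot := by
      refine Real.tendsto_log_nhdsNE_zero.comp ?_
      refine tendsto_nhdsWithin_iff.2 ⟨?_, ?_⟩
      · have : Filter.Tendsto (fun σ : ℝ => 1-σ) (nhds 1) (nhds (1-1)) :=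
          Continuous.tendsto (by fun_prop) 1
        rw [sub_self] at this
        exact this.mono_left nhdsWithin_le_nhds
      · filter_upwards [self_mem_nhdsWithin] with σ a
        exact sub_ne_zero.2 a.2.symm
    simp only [sub_eq_add_neg (Real.log _)]
    exact Filter.tendsto_atTop_add_const_left _ _ (Filter.tendsto_neg_atBot_atTop.comp hlog)
end

section
/- Let n ≥ 2 be an integer and let α be a real number with 0 ≤ α < 2. Then there exists σ with 1/2 < σ < 1 such that Δ(σ) := (tr A(σ))² − 4·det A(σ) < 0. Consequently, for this σ there exist a complex number z with Im z > 0 and a nonzero vector h ∈ ℂ² such that A(σ)·h = z·h. -/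
/-- `I_{n,α}(σ) = (σ/n) ∫_{-π}^{π} sin β sin(nβ)/|σ - e^{iβ}|^{2+α} dβ`. -/
noncomputable def Isin (n : ℕ) (α σ : ℝ) : ℝ :=
  (σ/(n:ℝ)) * ∫ β in (-Real.pi)..Real.pi,
    Real.sin β * Real.sin ((n:ℝ)*β) / (Kker σ β) ^ (2+α)

/-- The matrix `A(σ)` of the two-point linear stability system, where `Jval`
plays the role of `J_{n,α}(1)`. -/
noncomputable def Amat (n : ℕ) (α σ Jval : ℝ) : Matrix (Fin 2) (Fin 2) ℝ :=
  !![σ ^ (-(2+α)) * Jval - σ⁻¹ * Isin 1 α σ, σ⁻¹ * Isin n α σ;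
     -(σ⁻¹ * Isin n α σ), -Jval + σ⁻¹ * Isin 1 α σ]

open Filter Topology Real MeasureTheory

lemma aux_abs_sin (n : ℕ) (β : ℝ) : |sin (n * β)| ≤ n * |sin β| := by
  induction n with
  | zero => simp
  | succ k ih =>
    have e : ((k + 1 : ℕ) : ℝ) * β = k * β + β := by push_cast; ring
    rw [e, sin_add]
    have h1 : |sin (k * β) * cos β| ≤ |sin (k * β)| := by
      rw [abs_mul]
      exact mul_le_of_le_one_right (abs_nonneg _) (abs_cos_le_one β)
    have h2 : |cos (k * β) * sin β| ≤ |sin β| := by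
      rw [abs_mul]
      exact mul_le_of_le_one_left (abs_nonneg _) (abs_cos_le_one _)
    have h3 := abs_add_le (sin (k * β) * cos β) (cos (k * β) * sin β)
    push_cast
    linarith

lemma aux_num_nonneg (n : ℕ) (hn : 2 ≤ n) (β : ℝ) :
    0 ≤ sin β * sin β - sin β * sin (n * β) / n := by
  have h := aux_abs_sin n β
  have hn' : (0 : ℝ) < n := by positivity
  rw [sub_nonneg, div_le_iff₀ hn']
  calc sin β * sin (n * β) ≤ |sin β * sin (n * β)| := le_abs_self _
    _ = |sin β| * |sin (n * β)| := abs_mul _ _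
    _ ≤ |sin β| * (n * |sin β|) := by gcongr
    _ = n * (|sin β| * |sin β|) := by ring
    _ = sin β * sin β * n := by rw [abs_mul_abs_self]; ring

/-- moments -/
noncomputable def auxW (k m : ℕ) : ℝ :=
  ∫ β in (-π)..π, sin β * sin (m * β) * cos β ^ k

lemma auxW_succ (k m : ℕ) : auxW (k + 1) (m + 1) = (auxW k (m + 2) + auxW k m) / 2 := by
  unfold auxW
  rw [← intervalIntegral.integral_add (Continuous.intervalIntegrable (by fun_prop) _ _)
    (Continuous.intervalIntegrable (by fun_prop) _ _), ← intervalIntegral.integral_div]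
  congr 1
  ext β
  have e1 : ((m + 2 : ℕ) : ℝ) * β = ((m + 1 : ℕ) : ℝ) * β + β := by push_cast; ring
  have e2 : (m : ℝ) * β = ((m + 1 : ℕ) : ℝ) * β - β := by push_cast; ring
  rw [e1, e2, sin_add, sin_sub]
  ring

lemma auxW_zero_right (k : ℕ) : auxW k 0 = 0 := by simp [auxW]

lemma auxW_zero_one : auxW 0 1 = π := by
  have : auxW 0 1 = ∫ β in (-π)..π, sin β ^ 2 := by
    unfold auxW; congr 1; ext β; simp; ring
  rw [this, integral_sin_sq]; simp

lemma auxW_zero_left (m : ℕ) : auxW 0 (m + 2) = 0 := by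
  have h : ∀ j : ℕ, ∫ β in (-π)..π, cos (((j + 1 : ℕ) : ℝ) * β) = 0 := by
    intro j
    have hj : ((j + 1 : ℕ) : ℝ) ≠ 0 := by positivity
    rw [intervalIntegral.integral_comp_mul_left (fun x => cos x) hj, integral_cos]
    have := sin_nat_mul_pi (j + 1)
    simp only [mul_neg, sin_neg, this]; simp
  have e : auxW 0 (m + 2) = ((∫ β in (-π)..π, cos (((m + 1 : ℕ) : ℝ) * β)) -
      ∫ β in (-π)..π, cos (((m + 2 + 1 : ℕ) : ℝ) * β)) / 2 := by
    unfold auxW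
    rw [← intervalIntegral.integral_sub (Continuous.intervalIntegrable (by fun_prop) _ _)
      (Continuous.intervalIntegrable (by fun_prop) _ _), ← intervalIntegral.integral_div]
    congr 1
    ext β
    have e1 : ((m + 1 : ℕ) : ℝ) * β = ((m + 2 : ℕ) : ℝ) * β - β := by push_cast; ring
    have e2 : ((m + 2 + 1 : ℕ) : ℝ) * β = ((m + 2 : ℕ) : ℝ) * β + β := by push_cast; ring
    rw [e1, e2, cos_add, cos_sub]
    ring
  rw [e, h m, h (m + 2)]; simp

lemma auxW_nonneg (k : ℕ) : ∀ m, 0 ≤ auxW k m := by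
  induction k with
  | zero =>
    intro m
    match m with
    | 0 => rw [auxW_zero_right]
    | 1 => rw [auxW_zero_one]; positivity
    | m + 2 => rw [auxW_zero_left]
  | succ k ih =>
    intro m
    match m with
    | 0 => rw [auxW_zero_right]
    | m + 1 => rw [auxW_succ]; linarith [ih (m + 2), ih m]

lemma auxW_pos (k : ℕ) : 0 < auxW k (k + 1) := by
  induction k with
  | zero => rw [auxW_zero_one]; positivity
  | succ k ih => rw [auxW_succ]; linarith [auxW_nonneg k (k + 1 + 2)]

/-- binomial coefficients -/
noncomputable def auxa (p : ℝ) (k : ℕ) : ℝ := Ring.choose (p + k - 1) k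

lemma auxa_pos (p : ℝ) (hp : 0 < p) (k : ℕ) : 0 < auxa p k := by
  unfold auxa
  rw [← Ring.multichoose_eq]
  have h := Ring.factorial_nsmul_multichoose_eq_ascPochhammer p k
  rw [Polynomial.ascPochhammer_smeval_eq_eval, nsmul_eq_mul] at h
  have h2 := ascPochhammer_pos k p hp
  rw [← h] at h2
  exact pos_of_mul_pos_right h2 (by positivity)

lemma aux_hasSum (p x : ℝ) (hx : |x| < 1) :
    HasSum (fun k => auxa p k * x ^ k) (1 / (1 - x) ^ p) := by
  have h := (Real.one_div_one_sub_rpow_hasFPowerSeriesOnBall_zero p).hasSum (y := x) (by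
    simpa [Metric.mem_eball, edist_dist, ← enorm_eq_nnnorm, ENNReal.ofReal_lt_one] using hx)
  simpa [FormalMultilinearSeries.ofScalars_apply_eq, auxa, mul_comm] using h

/-- kernel -/
noncomputable def auxX (σ β : ℝ) : ℝ := σ + σ⁻¹ - 2 * cos β

lemma auxc_gt (σ : ℝ) (h0 : 0 < σ) (h1 : σ < 1) : 2 < σ + σ⁻¹ := by
  have : σ + σ⁻¹ - 2 = (1 - σ) ^ 2 / σ := by field_simp; ring
  have h2 : 0 < (1 - σ) ^ 2 / σ := by have : 0 < 1 - σ := by linarith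
                                      positivity
  linarith

lemma auxX_pos (σ β : ℝ) (h0 : 0 < σ) (h1 : σ < 1) : 0 < auxX σ β := by
  have := auxc_gt σ h0 h1
  have := cos_le_one β
  unfold auxX; linarith

lemma auxX_cont (σ p : ℝ) (h0 : 0 < σ) (h1 : σ < 1) : Continuous fun β => auxX σ β ^ p := by
  have : Continuous fun β => auxX σ β := by unfold auxX; fun_prop
  exact this.rpow_const (fun β => Or.inl (auxX_pos σ β h0 h1).ne')

noncomputable def auxT (n : ℕ) (p σ : ℝ) : ℝ :=
  ∫ β in (-π)..π, sin β * sin (n * β) / auxX σ β ^ p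

lemma aux_ker (α σ β : ℝ) (h0 : 0 < σ) (h1 : σ < 1) :
    Kker σ β ^ (2 + α) = σ ^ (1 + α / 2) * auxX σ β ^ (1 + α / 2) := by
  have hX := auxX_pos σ β h0 h1
  rw [← mul_rpow h0.le hX.le]
  have e : σ ^ 2 - 2 * σ * cos β + 1 = σ * auxX σ β := by
    unfold auxX; field_simp; ring
  rw [Kker, e, sqrt_eq_rpow, ← rpow_mul (by positivity)]
  congr 1; ring

lemma aux_Isin (n : ℕ) (α σ : ℝ) (h0 : 0 < σ) (h1 : σ < 1) :
    σ⁻¹ * Isin n α σ = σ ^ (-(1 + α / 2)) * (auxT n (1 + α / 2) σ / n) := by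
  have : (∫ β in (-π)..π, sin β * sin (n * β) / (Kker σ β) ^ (2 + α))
      = σ ^ (-(1 + α / 2)) * auxT n (1 + α / 2) σ := by
    unfold auxT
    rw [← intervalIntegral.integral_const_mul]
    congr 1
    ext β
    rw [aux_ker α σ β h0 h1, rpow_neg h0.le]
    field_simp
  rw [Isin, this]
  field_simp

lemma auxT_hasSum (n : ℕ) (p σ : ℝ) (h0 : 0 < σ) (h1 : σ < 1) :
    HasSum (fun k => (σ + σ⁻¹) ^ (-p) * (auxa p k * (2 / (σ + σ⁻¹)) ^ k * auxW k n))
      (auxT n p σ) := by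
  have hc := auxc_gt σ h0 h1
  set c := σ + σ⁻¹ with hcdef
  have hr1 : 2 / c < 1 := by rw [div_lt_one (by linarith)]; exact hc
  have hr0 : 0 < 2 / c := by positivity
  have key : ∀ β, HasSum (fun k => c ^ (-p) * (auxa p k * (2 / c) ^ k *
      (sin β * sin (n * β) * cos β ^ k))) (sin β * sin (n * β) / auxX σ β ^ p) := by
    intro β
    have hx : |2 / c * cos β| < 1 := by
      rw [abs_mul, abs_of_pos hr0]
      nlinarith [abs_cos_le_one β, abs_nonneg (cos β)]
    have h := (aux_hasSum p _ hx).mul_left (c ^ (-p) * (sin β * sin (n * β)))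
    have e1 : auxX σ β = c * (1 - 2 / c * cos β) := by
      unfold auxX; rw [← hcdef]; field_simp
    have h1x : 0 < 1 - 2 / c * cos β := by linarith [(abs_lt.1 hx).2]
    have e2 : sin β * sin (n * β) / auxX σ β ^ p =
        c ^ (-p) * (sin β * sin (n * β)) * (1 / (1 - 2 / c * cos β) ^ p) := by
      rw [e1, mul_rpow (by linarith) h1x.le, rpow_neg (by linarith)]
      field_simp
    rw [e2]
    have e3 : (fun k => c ^ (-p) * (auxa p k * (2 / c) ^ k *
        (sin β * sin (n * β) * cos β ^ k))) = fun k =>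
        c ^ (-p) * (sin β * sin (n * β)) * (auxa p k * (2 / c * cos β) ^ k) := by
      ext k
      rw [mul_pow]; ring
    rw [e3]
    exact h
  have hsum := (aux_hasSum p (2 / c) (by rwa [abs_of_pos hr0])).summable
  have hb : Summable (fun k => c ^ (-p) * |auxa p k * (2 / c) ^ k|) :=
    hsum.abs.mul_left _
  have H := intervalIntegral.hasSum_integral_of_dominated_convergence (μ := volume)
    (a := -π) (b := π)
    (F := fun k β => c ^ (-p) * (auxa p k * (2 / c) ^ k * (sin β * sin (n * β) * cos β ^ k)))
    (f := fun β => sin β * sin (n * β) / auxX σ β ^ p)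
    (fun k _ => c ^ (-p) * |auxa p k * (2 / c) ^ k|)
    (fun k => (by fun_prop : Continuous _).aestronglyMeasurable)
    (fun k => Eventually.of_forall fun β _ => by
      have hcp : 0 < c ^ (-p) := rpow_pos_of_pos (by linarith) _
      rw [norm_mul, norm_mul, Real.norm_eq_abs, Real.norm_eq_abs, Real.norm_eq_abs,
        abs_of_pos hcp]
      have : |sin β * sin (n * β) * cos β ^ k| ≤ 1 := by
        rw [abs_mul, abs_mul, abs_pow]
        have a1 := abs_sin_le_one β
        have a2 := abs_sin_le_one (n * β)
        have a3 := pow_le_one₀ (n := k) (abs_nonneg _) (abs_cos_le_one β)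
        calc _ ≤ (1 : ℝ) * 1 * 1 := by gcongr
          _ = 1 := by norm_num
      gcongr
      exact mul_le_of_le_one_right (abs_nonneg _) this)
    (Eventually.of_forall fun β _ => hb)
    intervalIntegrable_const
    (Eventually.of_forall fun β _ => key β)
  simpa only [intervalIntegral.integral_const_mul, auxW, auxT] using H

lemma auxT_lower (n : ℕ) (hn : 2 ≤ n) (p : ℝ) (hp : 0 < p) :
    ∃ c0 > 0, ∀ σ, 1 / 2 < σ → σ < 1 → c0 ≤ auxT n p σ := by
  have hW : 0 < auxW (n - 1) n := by
    have := auxW_pos (n - 1)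
    rwa [Nat.sub_add_cancel (by omega)] at this
  have ha := auxa_pos p hp (n - 1)
  refine ⟨(5 / 2 : ℝ) ^ (-p) * (auxa p (n - 1) * (4 / 5) ^ (n - 1) * auxW (n - 1) n),
    by positivity, ?_⟩
  intro σ h0 h1
  have hσ : 0 < σ := by linarith
  have hc := auxc_gt σ hσ h1
  have hc2 : σ + σ⁻¹ ≤ 5 / 2 := by
    have : 5 / 2 - (σ + σ⁻¹) = (σ - 1 / 2) * (2 - σ) / σ := by field_simp; ring
    have h2 : 0 < (σ - 1 / 2) * (2 - σ) / σ :=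
      div_pos (mul_pos (by linarith) (by linarith)) hσ
    linarith
  have hcp : (5 / 2 : ℝ) ^ (-p) ≤ (σ + σ⁻¹) ^ (-p) :=
    rpow_le_rpow_of_nonpos (by linarith) hc2 (by linarith)
  have hr : (4 / 5 : ℝ) ≤ 2 / (σ + σ⁻¹) := by
    rw [le_div_iff₀ (by linarith)]; linarith
  have h := le_hasSum (auxT_hasSum n p σ hσ h1) (n - 1) (fun k _ => by
    have := auxa_pos p hp k
    have := auxW_nonneg k n
    positivity)
  refine le_trans ?_ h
  gcongr

noncomputable def auxD (n : ℕ) (p σ : ℝ) : ℝ :=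
  ∫ β in (-π)..π, (sin β * sin β - sin β * sin (n * β) / n) / auxX σ β ^ p

lemma auxD_cont (n : ℕ) (p σ : ℝ) (h0 : 0 < σ) (h1 : σ < 1) :
    Continuous fun β => (sin β * sin β - sin β * sin (n * β) / n) / auxX σ β ^ p := by
  refine Continuous.div (by fun_prop) (auxX_cont σ p h0 h1) ?_
  intro β
  exact (rpow_pos_of_pos (auxX_pos σ β h0 h1) _).ne'

lemma auxD_eq (n : ℕ) (p σ : ℝ) (h0 : 0 < σ) (h1 : σ < 1) :
    auxD n p σ = auxT 1 p σ / (1 : ℕ) - auxT n p σ / n := by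
  have hc : ∀ m : ℕ, Continuous fun β => sin β * sin (m * β) / auxX σ β ^ p := fun m =>
    Continuous.div (by fun_prop) (auxX_cont σ p h0 h1)
      (fun β => (rpow_pos_of_pos (auxX_pos σ β h0 h1) _).ne')
  unfold auxD auxT
  rw [← intervalIntegral.integral_div, ← intervalIntegral.integral_div,
    ← intervalIntegral.integral_sub (Continuous.intervalIntegrable ((hc _).div_const _) _ _)
      (Continuous.intervalIntegrable ((hc _).div_const _) _ _)]
  congr 1
  ext β
  simp only [Nat.cast_one, one_mul, div_one]
  ring

lemma auxD_mono (n : ℕ) (hn : 2 ≤ n) (p σ s : ℝ) (hp : 0 < p) (h0 : 0 < σ) (hs : σ ≤ s)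
    (h1 : s < 1) : auxD n p σ ≤ auxD n p s := by
  have hs0 : 0 < s := by linarith
  have hσ1 : σ < 1 := by linarith
  unfold auxD
  apply intervalIntegral.integral_mono (by linarith [pi_pos])
    ((auxD_cont n p σ h0 hσ1).intervalIntegrable _ _)
    ((auxD_cont n p s hs0 h1).intervalIntegrable _ _)
  intro β
  have hX := auxX_pos s β hs0 h1
  have hle : auxX s β ≤ auxX σ β := by
    have : auxX σ β - auxX s β = (s - σ) * (1 - σ * s) / (σ * s) := by
      unfold auxX; field_simp; ring
    have h2 : 0 ≤ (s - σ) * (1 - σ * s) / (σ * s) :=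
      div_nonneg (mul_nonneg (by linarith) (by nlinarith)) (by positivity)
    linarith
  have := aux_num_nonneg n hn β
  dsimp only
  gcongr

lemma auxD_pos (n : ℕ) (hn : 2 ≤ n) (p σ : ℝ) (h0 : 0 < σ) (h1 : σ < 1) : 0 < auxD n p σ := by
  unfold auxD
  have hn' : (2 : ℝ) ≤ n := by exact_mod_cast hn
  have hpi := pi_pos
  have hlt : π / n < π := div_lt_self hpi (by linarith)
  have hgt : 0 < π / n := by positivity
  apply intervalIntegral.integral_pos (by linarith) (auxD_cont n p σ h0 h1).continuousOn
  · intro β _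
    exact div_nonneg (aux_num_nonneg n hn β) (rpow_nonneg (auxX_pos σ β h0 h1).le _)
  · refine ⟨π / n, ⟨by linarith, hlt.le⟩, ?_⟩
    apply div_pos _ (rpow_pos_of_pos (auxX_pos σ _ h0 h1) _)
    have e : (n : ℝ) * (π / n) = π := by field_simp
    have := sin_pos_of_pos_of_lt_pi hgt hlt
    rw [e, sin_pi]
    simp only [mul_zero, zero_div, sub_zero]
    positivity

lemma aux_eig (M : Matrix (Fin 2) (Fin 2) ℝ) (hΔ : (Matrix.trace M) ^ 2 - 4 * M.det < 0) :
    ∃ z : ℂ, 0 < z.im ∧ ∃ h : Fin 2 → ℂ, h ≠ 0 ∧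
      Matrix.mulVec (M.map (Complex.ofReal)) h = z • h := by
  set w := Real.sqrt (-((Matrix.trace M) ^ 2 - 4 * M.det)) with hw
  have hw0 : 0 < w := Real.sqrt_pos.2 (by linarith)
  have hw2 : w ^ 2 = -((Matrix.trace M) ^ 2 - 4 * M.det) := Real.sq_sqrt (by linarith)
  rw [Matrix.trace_fin_two, Matrix.det_fin_two] at *
  have hz : (⟨(M 0 0 + M 1 1) / 2, w / 2⟩ : ℂ) - M 0 0 ≠ 0 := by
    intro h
    have := congrArg Complex.im h
    simp at this
    linarith
  refine ⟨⟨(M 0 0 + M 1 1) / 2, w / 2⟩, by simpa using hw0,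
    ![(M 0 1 : ℂ), ⟨(M 0 0 + M 1 1) / 2, w / 2⟩ - M 0 0], ?_, ?_⟩
  · intro h
    exact hz (by simpa using congrFun h 1)
  · ext i
    fin_cases i
    · simp [Matrix.mulVec, dotProduct, Fin.sum_univ_two]; ring
    · simp only [Matrix.mulVec, dotProduct, Fin.sum_univ_two]
      apply Complex.ext
      · simp
        nlinarith
      · simp
        ring

theorem stmt9 (n : ℕ) (hn : 2 ≤ n) (α : ℝ) (hα0 : 0 ≤ α) (hα2 : α < 2) (Jval : ℝ)
    (hJ : Filter.Tendsto (fun s => Isin 1 α s - Isin n α s)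
      (nhdsWithin 1 {s : ℝ | 0 < s ∧ s ≠ 1}) (nhds Jval)) :
    ∃ σ : ℝ, 1/2 < σ ∧ σ < 1 ∧
      (Matrix.trace (Amat n α σ Jval))^2 - 4 * (Amat n α σ Jval).det < 0 ∧
      ∃ z : ℂ, 0 < z.im ∧ ∃ h : Fin 2 → ℂ, h ≠ 0 ∧
        Matrix.mulVec ((Amat n α σ Jval).map (Complex.ofReal)) h = z • h := by
  suffices H : ∃ σ : ℝ, 1/2 < σ ∧ σ < 1 ∧
      (Matrix.trace (Amat n α σ Jval))^2 - 4 * (Amat n α σ Jval).det < 0 by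
    obtain ⟨σ, h1, h2, h3⟩ := H
    exact ⟨σ, h1, h2, h3, aux_eig _ h3⟩
  set p := 1 + α / 2 with hp
  have hp0 : 0 < p := by positivity
  have hn' : (0 : ℝ) < n := by positivity
  -- the interval to the left of one
  have hmem : ∀ᶠ s : ℝ in 𝓝[<] 1, 1 / 2 < s ∧ s < 1 := by
    have : Set.Ioo (1 / 2 : ℝ) 1 ∈ 𝓝[<] (1 : ℝ) := Ioo_mem_nhdsLT (by norm_num)
    exact this
  have hJ' : Tendsto (fun s => Isin 1 α s - Isin n α s) (𝓝[<] 1) (𝓝 Jval) := by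
    refine hJ.mono_left ?_
    refine le_inf inf_le_left ?_
    rw [le_principal_iff]
    filter_upwards [hmem] with s hs
    exact ⟨by linarith [hs.1], hs.2.ne⟩
  have hpow : ∀ q : ℝ, Tendsto (fun s : ℝ => s ^ q) (𝓝[<] 1) (𝓝 1) := by
    intro q
    have : ContinuousAt (fun s : ℝ => s ^ q) 1 :=
      continuousAt_rpow_const _ _ (Or.inl one_ne_zero)
    have h := this.tendsto
    rw [one_rpow] at h
    exact h.mono_left nhdsWithin_le_nhds
  have hinv : Tendsto (fun s : ℝ => s⁻¹) (𝓝[<] 1) (𝓝 1) := by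
    simpa [rpow_neg_one] using hpow (-1)
  have hdiff : ∀ s : ℝ, 0 < s → s < 1 →
      s⁻¹ * (Isin 1 α s - Isin n α s) = s ^ (-p) * auxD n p s := by
    intro s h0 h1
    rw [mul_sub, aux_Isin 1 α s h0 h1, aux_Isin n α s h0 h1, auxD_eq n p s h0 h1]
    ring
  have hD : Tendsto (fun s => auxD n p s) (𝓝[<] 1) (𝓝 Jval) := by
    have h := (hpow p).mul (hinv.mul hJ')
    rw [one_mul, one_mul] at h
    refine h.congr' ?_
    filter_upwards [hmem] with s hs
    have h0 : 0 < s := by linarith [hs.1]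
    rw [hdiff s h0 hs.2, ← mul_assoc, ← rpow_add h0]
    simp
  have hDle : ∀ s : ℝ, 0 < s → s < 1 → auxD n p s ≤ Jval := by
    intro s h0 h1
    refine ge_of_tendsto hD ?_
    have : Set.Ioo s 1 ∈ 𝓝[<] (1 : ℝ) := Ioo_mem_nhdsLT h1
    filter_upwards [this] with t ht
    exact auxD_mono n hn p s t hp0 h0 ht.1.le ht.2
  have hJpos : 0 < Jval :=
    lt_of_lt_of_le (auxD_pos n hn p (1 / 2) (by norm_num) (by norm_num))
      (hDle (1 / 2) (by norm_num) (by norm_num))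
  obtain ⟨c0, hc0, hlow⟩ := auxT_lower n hn p hp0
  have hG : Tendsto (fun s : ℝ => (s ^ (-(2 + α)) + 1) * Jval
      - 2 * (s⁻¹ * (Isin 1 α s - Isin n α s))) (𝓝[<] 1) (𝓝 0) := by
    have h := (((hpow (-(2 + α))).add_const 1).mul_const Jval).sub
      ((hinv.mul hJ').const_mul 2)
    convert h using 2
    ring
  have hGs : ∀ᶠ s : ℝ in 𝓝[<] 1, (s ^ (-(2 + α)) + 1) * Jval
      - 2 * (s⁻¹ * (Isin 1 α s - Isin n α s)) < c0 / n :=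
    hG.eventually_lt_const (by positivity)
  obtain ⟨σ, hσ, hlt⟩ := (hmem.and hGs).exists
  refine ⟨σ, hσ.1, hσ.2, ?_⟩
  have h0 : 0 < σ := by linarith [hσ.1]
  have hq : 1 < σ ^ (-p) := one_lt_rpow_of_pos_of_lt_one_of_neg h0 hσ.2 (by linarith)
  have hsq : σ ^ (-(2 + α)) = σ ^ (-p) * σ ^ (-p) := by
    rw [← rpow_add h0]; congr 1; rw [hp]; ring
  have hGpos : 0 < (σ ^ (-(2 + α)) + 1) * Jval
      - 2 * (σ⁻¹ * (Isin 1 α σ - Isin n α σ)) := by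
    rw [hdiff σ h0 hσ.2, hsq]
    have h1 := hDle σ h0 hσ.2
    have h2 : σ ^ (-p) * auxD n p σ ≤ σ ^ (-p) * Jval := by gcongr
    have h3 : 0 < (σ ^ (-p) - 1) ^ 2 * Jval := mul_pos (pow_pos (by linarith) 2) hJpos
    nlinarith
  have hy : c0 / n ≤ σ⁻¹ * Isin n α σ := by
    rw [aux_Isin n α σ h0 hσ.2]
    have h1 : c0 / n ≤ auxT n p σ / n := by
      have := hlow σ hσ.1 hσ.2
      gcongr
    have h2 : 0 < c0 / n := by positivity
    exact h1.trans (le_mul_of_one_le_left (by linarith) hq.le)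
  have hy0 : 0 < c0 / n := by positivity
  rw [Matrix.trace_fin_two, Matrix.det_fin_two]
  simp only [Amat, Matrix.of_apply, Matrix.cons_val', Matrix.cons_val_zero, Matrix.cons_val_one,
    Matrix.cons_val_fin_one]
  set y := σ⁻¹ * Isin n α σ with hyd
  set x := σ⁻¹ * Isin 1 α σ with hxd
  rw [mul_sub, ← hyd, ← hxd] at hlt hGpos
  have := mul_pos hGpos (by linarith : 0 < 4 * y - ((σ ^ (-(2 + α)) + 1) * Jval - 2 * (x - y)))
  nlinarith
end
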